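/- Let P^•, Q^• be transverse complete flags in H, let a_•, b_• be strictly increasing sequences as in the context, and let Λ ∈ Σ°_{P^•,a_•} ∩ Σ°_{Q^•,b_•}. Then dim_k T(Λ) = E, where T(Λ) and E are as defined in the context. -/

import Mathlib

open Module Submodule

section Defs

variable (k : Type*) [Field k] {H : Type*} [AddCommGroup H] [Module k H]

/-- A complete flag in `H`, indexed by codimension: `P 0 = H ⊇ P 1 ⊇ ⋯ ⊇ P d = 0`
with `dim (P i) = d - i`. -/
def IsCompleteFlag (d : ℕ) (P : ℕ → Submodule k H) : Prop :=
  (∀ i ≤ d, Module.finrank k ↥(P i) = d - i) ∧ ∀ i < d, P (i + 1) ≤ P i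

/-- `e` is a `(P,Q)`-basis with associated permutation `τ` (0-indexed: the basis vector
`e ℓ` corresponds to `e_{ℓ+1}` of the paper, and `(τ ℓ).val + 1` to `τ(ℓ+1)`):
`e ℓ ∈ P^ℓ ∖ P^{ℓ+1}` and `e ℓ ∈ Q^{τ ℓ} ∖ Q^{τ ℓ + 1}`. -/
def IsFlagPermBasis (d : ℕ) (P Q : ℕ → Submodule k H)
    (τ : Equiv.Perm (Fin d)) (e : Fin d → H) : Prop :=
  LinearIndependent k e ∧ Submodule.span k (Set.range e) = ⊤ ∧
  (∀ ℓ : Fin d, e ℓ ∈ P ℓ.val ∧ e ℓ ∉ P (ℓ.val + 1)) ∧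
  (∀ ℓ : Fin d, e ℓ ∈ Q (τ ℓ).val ∧ e ℓ ∉ Q ((τ ℓ).val + 1))

/-- Complete flags `P`, `Q` are transverse: `P^i ∩ Q^{d-i} = 0` for `0 < i < d`. -/
def FlagsTransverse (d : ℕ) (P Q : ℕ → Submodule k H) : Prop :=
  ∀ i, 0 < i → i < d → P i ⊓ Q (d - i) = ⊥

/-- Complete flags `P`, `Q` are almost-transverse. -/
def FlagsAlmostTransverse (d : ℕ) (P Q : ℕ → Submodule k H) : Prop :=
  ∃ t, 1 ≤ t ∧ t < d ∧ Module.finrank k ↥(P t ⊓ Q (d - t)) = 1 ∧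
    ∀ i, 1 ≤ i → i < d → i ≠ t → Module.finrank k ↥(P i ⊓ Q (d - i)) = 0

/-- The index `i` is active in the sequence `a`. -/
def ActiveIdx (a : ℕ → ℕ) (i : ℕ) : Prop :=
  (i = 0 ∧ 0 < a 0) ∨ (0 < i ∧ a (i - 1) + 1 < a i)

/-- `Λ` lies in the Schubert variety `Σ_{P,a}` (for `Λ` of dimension `r+1`). -/
def MemSchubert (r : ℕ) (P : ℕ → Submodule k H) (a : ℕ → ℕ) (Λ : Submodule k H) : Prop :=
  ∀ i ≤ r, r + 1 - i ≤ Module.finrank k ↥(Λ ⊓ P (a i))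

/-- `Λ` lies in the open subset `Σ°_{P,a}` of the Schubert variety. -/
def MemSchubertOpen (r : ℕ) (P : ℕ → Submodule k H) (a : ℕ → ℕ) (Λ : Submodule k H) : Prop :=
  MemSchubert k r P a Λ ∧
    ∀ i ≤ r, ActiveIdx a i → Module.finrank k ↥(Λ ⊓ P (a i)) = r + 1 - i

/-- `lam` is an adapted basis of `Λ` for the flags `Λ ∩ P^•` and `Λ ∩ Q^•`, with associated
permutation `σ`: `lam j` lies in the codimension-`j` member of the flag `Λ ∩ P^•` but not in
the codimension-`(j+1)` member (membership in a member of the flag `Λ ∩ P^•` being equivalent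
to that member having dimension at least `r + 1 - j`), and likewise for `Λ ∩ Q^•` with `σ j`
in place of `j`. -/
def IsAdaptedBasis (d r : ℕ) (P Q : ℕ → Submodule k H) (Λ : Submodule k H)
    (σ : Equiv.Perm (Fin (r + 1))) (lam : Fin (r + 1) → H) : Prop :=
  LinearIndependent k lam ∧ Submodule.span k (Set.range lam) = Λ ∧
  (∀ j : Fin (r + 1), ∀ i ≤ d,
    (lam j ∈ Λ ⊓ P i ↔ r + 1 - j.val ≤ Module.finrank k ↥(Λ ⊓ P i))) ∧
  (∀ j : Fin (r + 1), ∀ i ≤ d,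
    (lam j ∈ Λ ⊓ Q i ↔ r + 1 - (σ j).val ≤ Module.finrank k ↥(Λ ⊓ Q i)))

/-- The subspace of `Hom(Λ, H/Λ)` of maps `φ` with `φ(Λ ∩ P^{a i}) ⊆ (P^{a i} + Λ)/Λ`
for all `i ∈ S`. -/
def schubertTangent (P : ℕ → Submodule k H) (a : ℕ → ℕ) (Λ : Submodule k H) (S : Set ℕ) :
    Submodule k (↥Λ →ₗ[k] H ⧸ Λ) :=
  ⨅ i ∈ S, Submodule.compatibleMaps
    (Submodule.comap Λ.subtype (P (a i))) (Submodule.map Λ.mkQ (P (a i)))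

/-- The tangent-space model `T(Λ)` at `Λ ∈ Σ°_{P,a} ∩ Σ°_{Q,b}`: all `φ : Λ → H/Λ` with
`φ(Λ ∩ P^{a i}) ⊆ (P^{a i} + Λ)/Λ` for every `i` active in `a` and
`φ(Λ ∩ Q^{b i}) ⊆ (Q^{b i} + Λ)/Λ` for every `i` active in `b`. -/
def pairTangent (r : ℕ) (P Q : ℕ → Submodule k H) (a b : ℕ → ℕ) (Λ : Submodule k H) :
    Submodule k (↥Λ →ₗ[k] H ⧸ Λ) :=
  schubertTangent k P a Λ {i | i ≤ r ∧ ActiveIdx a i} ⊓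
    schubertTangent k Q b Λ {i | i ≤ r ∧ ActiveIdx b i}

/-- The number of inversions of a permutation of `Fin d`. -/
def invCount {d : ℕ} (τ : Equiv.Perm (Fin d)) : ℕ :=
  ((Finset.univ : Finset (Fin d × Fin d)).filter fun p => p.1 < p.2 ∧ τ p.2 < τ p.1).card

end Defs

section FlagLemmas

variable {k H : Type*} [Field k] [AddCommGroup H] [Module k H]

theorem IsCompleteFlag.antitone {d : ℕ} {P : ℕ → Submodule k H} (hP : IsCompleteFlag k d P)
    {i j : ℕ} (hij : i ≤ j) (hj : j ≤ d) : P j ≤ P i := by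
  induction j, hij using Nat.le_induction with
  | base => exact le_rfl
  | succ j _ ih => exact (hP.2 j (by omega)).trans (ih (by omega))

theorem IsCompleteFlag.zero_eq_top [FiniteDimensional k H] {d : ℕ} {P : ℕ → Submodule k H}
    (hP : IsCompleteFlag k d P) (hH : finrank k H = d) : P 0 = ⊤ :=
  Submodule.eq_top_of_finrank_eq (by rw [hP.1 0 (Nat.zero_le d), hH, Nat.sub_zero])

theorem IsCompleteFlag.last_eq_bot [FiniteDimensional k H] {d : ℕ} {P : ℕ → Submodule k H}
    (hP : IsCompleteFlag k d P) : P d = ⊥ :=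
  Submodule.finrank_eq_zero.mp (by rw [hP.1 d le_rfl, Nat.sub_self])

/-- A member `P i` of a complete flag is spanned by the vectors `e l`, `l ≥ i`, of any system
adapted to the flag. -/
theorem IsCompleteFlag.le_of_adapted [FiniteDimensional k H] {d : ℕ} {P : ℕ → Submodule k H}
    (hP : IsCompleteFlag k d P) {e : ℕ → H} (he : ∀ i < d, e i ∈ P i ∧ e i ∉ P (i + 1))
    {S : Submodule k H} {i : ℕ} (hi : i ≤ d) (hS : ∀ l < d, i ≤ l → e l ∈ S) : P i ≤ S := by
  induction hi using Nat.decreasingInduction with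
  | self => rw [hP.last_eq_bot]; exact bot_le
  | of_succ i hi ih =>
    have hlt : P (i + 1) < P (i + 1) ⊔ span k {e i} := by
      refine lt_of_le_of_ne le_sup_left fun h => (he i hi).2 ?_
      rw [h]
      exact mem_sup_right (mem_span_singleton_self _)
    have hle : P (i + 1) ⊔ span k {e i} ≤ P i :=
      sup_le (hP.2 i hi) ((span_singleton_le_iff_mem _ _).mpr (he i hi).1)
    have hdim := Submodule.finrank_lt_finrank_of_lt hlt
    have heq := Submodule.eq_of_le_of_finrank_le hle (by
      have h1 := hP.1 i hi.le
      have h2 := hP.1 (i + 1) hi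
      omega)
    rw [← heq]
    exact sup_le (ih fun l hl hil => hS l hl (by omega))
      ((span_singleton_le_iff_mem _ _).mpr (hS i hi le_rfl))

theorem IsCompleteFlag.exists_adapted [FiniteDimensional k H] {d : ℕ} {P : ℕ → Submodule k H}
    (hP : IsCompleteFlag k d P) : ∃ e : ℕ → H, ∀ i < d, e i ∈ P i ∧ e i ∉ P (i + 1) := by
  have h : ∀ i, ∃ x, i < d → x ∈ P i ∧ x ∉ P (i + 1) := by
    intro i
    by_cases hi : i < d
    · obtain ⟨x, hx⟩ := SetLike.not_le_iff_exists.mp (fun hle : P i ≤ P (i + 1) => by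
        have h0 := Submodule.finrank_mono hle
        have h1 := hP.1 i hi.le
        have h2 := hP.1 (i + 1) hi
        omega)
      exact ⟨x, fun _ => hx⟩
    · exact ⟨0, fun h => absurd h hi⟩
  choose e he using h
  exact ⟨e, he⟩

theorem IsCompleteFlag.exists_basis [FiniteDimensional k H] {d : ℕ} {P : ℕ → Submodule k H}
    (hP : IsCompleteFlag k d P) (hH : finrank k H = d) {e : ℕ → H}
    (he : ∀ i < d, e i ∈ P i ∧ e i ∉ P (i + 1)) :
    ∃ B : Basis (Fin d) k H, ∀ i : Fin d, B i = e i := by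
  have hspan : ⊤ ≤ span k (Set.range fun i : Fin d => e i) := by
    rw [← hP.zero_eq_top hH]
    exact hP.le_of_adapted he (Nat.zero_le d) fun l hl _ =>
      subset_span ⟨⟨l, hl⟩, rfl⟩
  exact ⟨basisOfTopLeSpanOfCardEqFinrank _ hspan (by simp [hH]), fun i => by simp⟩

theorem finrank_comap_subtype_eq_inf (Λ S : Submodule k H) :
    finrank k ↥(S.comap Λ.subtype) = finrank k ↥(Λ ⊓ S) := by
  rw [← Submodule.map_comap_subtype, Submodule.finrank_map_subtype_eq]

theorem finrank_map_mkQ_add_finrank_inf [FiniteDimensional k H] (Λ S : Submodule k H) :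
    finrank k ↥(S.map Λ.mkQ) + finrank k ↥(Λ ⊓ S) = finrank k ↥S := by
  have h := LinearMap.finrank_range_add_finrank_ker (Λ.mkQ.domRestrict S)
  rwa [LinearMap.range_domRestrict, LinearMap.ker_domRestrict, Submodule.ker_mkQ,
    finrank_comap_subtype_eq_inf, inf_comm] at h

theorem IsCompleteFlag.finrank_inf_le_succ [FiniteDimensional k H] {d : ℕ}
    {P : ℕ → Submodule k H} (hP : IsCompleteFlag k d P) (Λ : Submodule k H) {t : ℕ} (ht : t < d) :
    finrank k ↥(Λ ⊓ P t) ≤ finrank k ↥(Λ ⊓ P (t + 1)) + 1 := by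
  have h := Submodule.finrank_sup_add_finrank_inf_eq (Λ ⊓ P t) (P (t + 1))
  rw [inf_assoc, inf_eq_right.mpr (hP.2 t ht)] at h
  have h0 := Submodule.finrank_mono (sup_le (inf_le_right : Λ ⊓ P t ≤ P t) (hP.2 t ht))
  have h1 := hP.1 t ht.le
  have h2 := hP.1 (t + 1) ht
  omega

theorem Nat.exists_eq_of_le_succ {f : ℕ → ℕ} {d m : ℕ} (hf : ∀ t < d, f t ≤ f (t + 1) + 1)
    (hm : m ≤ f 0) (hd : f d ≤ m) : ∃ t ≤ d, f t = m := by
  classical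
  have hex : ∃ t, f t ≤ m := ⟨d, hd⟩
  have hle : Nat.find hex ≤ d := Nat.find_min' hex hd
  refine ⟨Nat.find hex, hle, le_antisymm (Nat.find_spec hex) ?_⟩
  rcases h : Nat.find hex with _ | s
  · exact hm
  · have h1 := Nat.find_min hex (m := s) (by omega)
    have h2 := hf s (by omega)
    omega

theorem IsCompleteFlag.comap_eq_of_finrank_eq [FiniteDimensional k H] {d : ℕ}
    {P : ℕ → Submodule k H} (hP : IsCompleteFlag k d P) (Λ : Submodule k H) {s t : ℕ}
    (hs : s ≤ d) (ht : t ≤ d)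
    (h : finrank k ↥((P s).comap Λ.subtype) = finrank k ↥((P t).comap Λ.subtype)) :
    (P s).comap Λ.subtype = (P t).comap Λ.subtype := by
  rcases le_total s t with hst | hst
  · exact (Submodule.eq_of_le_of_finrank_eq (Submodule.comap_mono (hP.antitone hst ht)) h.symm).symm
  · exact Submodule.eq_of_le_of_finrank_eq (Submodule.comap_mono (hP.antitone hst hs)) h

/-- A complete flag of `H` induces a complete flag on every subspace `Λ`, each member being cut
out by some member of the original flag. -/
theorem IsCompleteFlag.exists_induced [FiniteDimensional k H] {d n : ℕ}
    {P : ℕ → Submodule k H} (hP : IsCompleteFlag k d P) (hH : finrank k H = d)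
    (Λ : Submodule k H) (hΛ : finrank k ↥Λ = n) :
    ∃ t : ℕ → ℕ, (∀ j ≤ n, t j ≤ d) ∧
      IsCompleteFlag k n fun j => (P (t j)).comap Λ.subtype := by
  have hex : ∀ j, ∃ t ≤ d, finrank k ↥((P t).comap Λ.subtype) = n - j := fun j => by
    simp_rw [finrank_comap_subtype_eq_inf]
    refine Nat.exists_eq_of_le_succ (f := fun t => finrank k ↥(Λ ⊓ P t))
      (fun t ht => hP.finrank_inf_le_succ Λ ht) ?_ ?_
    · rw [hP.zero_eq_top hH, inf_top_eq, hΛ]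
      exact Nat.sub_le n j
    · rw [hP.last_eq_bot, inf_bot_eq, finrank_bot]
      exact Nat.zero_le _
  choose t htd ht using hex
  refine ⟨t, fun j _ => htd j, fun j _ => ht j, fun j hj => ?_⟩
  rcases le_total (t j) (t (j + 1)) with h | h
  · exact Submodule.comap_mono (hP.antitone h (htd _))
  · have h0 := Submodule.finrank_mono (Submodule.comap_mono (f := Λ.subtype)
      (hP.antitone h (htd _)))
    rw [ht, ht] at h0
    omega

/-- The dimension of the space of linear maps sending each basis vector into a prescribed
subspace. -/
theorem finrank_of_mem_iff_basis {ι V W : Type*} [Fintype ι] [AddCommGroup V] [Module k V]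
    [AddCommGroup W] [Module k W] [FiniteDimensional k W] (B : Basis ι k V)
    (S : ι → Submodule k W) (T : Submodule k (V →ₗ[k] W))
    (hT : ∀ φ, φ ∈ T ↔ ∀ i, φ (B i) ∈ S i) :
    finrank k ↥T = ∑ i, finrank k ↥(S i) := by
  rw [← Module.finrank_pi_fintype k]
  exact LinearEquiv.finrank_eq
    { toFun := fun φ i => ⟨φ.1 (B i), (hT _).mp φ.2 i⟩
      map_add' := fun _ _ => rfl
      map_smul' := fun _ _ => rfl
      invFun := fun f => ⟨B.constr k fun i => (f i : W), (hT _).mpr fun i => by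
        rw [B.constr_basis]; exact (f i).2⟩
      left_inv := fun φ => Subtype.ext (B.ext fun i => by simp [B.constr_basis])
      right_inv := fun f => funext fun i => Subtype.ext (by simp [B.constr_basis]) }

theorem mem_schubertTangent {P : ℕ → Submodule k H} {a : ℕ → ℕ} {Λ : Submodule k H} {S : Set ℕ}
    {φ : ↥Λ →ₗ[k] H ⧸ Λ} :
    φ ∈ schubertTangent k P a Λ S ↔
      ∀ i ∈ S, (P (a i)).comap Λ.subtype ≤ ((P (a i)).map Λ.mkQ).comap φ := by
  simp only [schubertTangent, Submodule.mem_iInf]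
  rfl

/-- The last index `m ≤ j` that is active (or zero): between `m` and `j` the sequence increases in
unit steps. -/
theorem exists_last_active {r : ℕ} {a : ℕ → ℕ} (ha : ∀ i < r, a i < a (i + 1)) {j : ℕ}
    (hj : j ≤ r) : ∃ m ≤ j, (m = 0 ∨ ActiveIdx a m) ∧ a m + j = a j + m ∧
      ∀ i ≤ j, ActiveIdx a i → i ≤ m := by
  induction j with
  | zero => exact ⟨0, le_rfl, Or.inl rfl, rfl, fun i hi _ => hi⟩
  | succ j ih =>
    by_cases hact : ActiveIdx a (j + 1)
    · exact ⟨j + 1, le_rfl, Or.inr hact, rfl, fun i hi _ => hi⟩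
    · obtain ⟨m, hm, hm0, hmj, hmax⟩ := ih (by omega)
      have hstep : a (j + 1) = a j + 1 := by
        have h1 := ha j (by omega)
        have h2 : ¬ (a j + 1 < a (j + 1)) := fun h => hact (Or.inr ⟨by omega, by simpa using h⟩)
        omega
      refine ⟨m, by omega, hm0, by omega, fun i hi hai => ?_⟩
      have hne : i ≠ j + 1 := fun h => hact (h ▸ hai)
      exact hmax i (by omega) hai

theorem le_of_lt_succ_steps {r : ℕ} {a : ℕ → ℕ} (ha : ∀ i < r, a i < a (i + 1)) {i j : ℕ}
    (hij : i ≤ j) (hj : j ≤ r) : a i ≤ a j := by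
  induction j, hij using Nat.le_induction with
  | base => exact le_rfl
  | succ j _ ih => exact (ih (by omega)).trans (ha j (by omega)).le

theorem finrank_schubertTangent [FiniteDimensional k H] {d : ℕ} (hH : finrank k H = d)
    {P : ℕ → Submodule k H} (hP : IsCompleteFlag k d P) {r : ℕ} {a : ℕ → ℕ}
    (ha : ∀ i < r, a i < a (i + 1)) (had : a r < d) {Λ : Submodule k H}
    (hΛ : finrank k ↥Λ = r + 1) (hΛa : MemSchubertOpen k r P a Λ) :
    (finrank k ↥(schubertTangent k P a Λ {i | i ≤ r ∧ ActiveIdx a i}) : ℤ) =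
      ((r : ℤ) + 1) * ((d : ℤ) - (r : ℤ) - 1) -
        ∑ i ∈ Finset.range (r + 1), ((a i : ℤ) - (i : ℤ)) := by
  have hle : ∀ i ≤ r, a i ≤ d := fun i hi => (le_of_lt_succ_steps ha hi le_rfl).trans had.le
  obtain ⟨t, htd, hU⟩ := hP.exists_induced hH Λ hΛ
  obtain ⟨e, he⟩ := hU.exists_adapted
  obtain ⟨B, hB⟩ := hU.exists_basis hΛ he
  have hact : ∀ i ≤ r, i = 0 ∧ a 0 = 0 ∨ ActiveIdx a i →
      finrank k ↥(Λ ⊓ P (a i)) = r + 1 - i := by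
    rintro i hi (⟨rfl, h0⟩ | h)
    · rw [h0, hP.zero_eq_top hH, inf_top_eq, hΛ, Nat.sub_zero]
    · exact hΛa.2 i hi h
  have hcomap : ∀ i ≤ r, ActiveIdx a i →
      (P (a i)).comap Λ.subtype = (P (t i)).comap Λ.subtype := fun i hi h => by
    refine hP.comap_eq_of_finrank_eq Λ (hle i hi) (htd i (by omega)) ?_
    rw [finrank_comap_subtype_eq_inf, hact i hi (Or.inr h)]
    exact (hU.1 i (by omega)).symm
  have hm : ∀ j : Fin (r + 1), ∃ m ≤ j.val, (m = 0 ∧ a 0 = 0 ∨ ActiveIdx a m) ∧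
      a m + j = a j + m ∧ ∀ i ≤ j.val, ActiveIdx a i → i ≤ m := fun j => by
    obtain ⟨m, hmj, h0, h1, h2⟩ := exists_last_active ha (Nat.le_of_lt_succ j.2)
    refine ⟨m, hmj, ?_, h1, h2⟩
    rcases h0 with rfl | h0
    · rcases Nat.eq_zero_or_pos (a 0) with h | h
      · exact Or.inl ⟨rfl, h⟩
      · exact Or.inr (Or.inl ⟨rfl, h⟩)
    · exact Or.inr h0
  choose m hmj hm0 hma hmax using hm
  have hmr : ∀ j, m j ≤ r := fun j => (hmj j).trans (Nat.le_of_lt_succ j.2)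
  rw [finrank_of_mem_iff_basis B (fun j => (P (a (m j))).map Λ.mkQ), Nat.cast_sum,
    Finset.sum_range]
  · have hdim : ∀ j : Fin (r + 1), (finrank k ↥((P (a (m j))).map Λ.mkQ) : ℤ) =
        ((d : ℤ) - r - 1) - ((a j : ℤ) - (j : ℤ)) := fun j => by
      have h1 := finrank_map_mkQ_add_finrank_inf Λ (P (a (m j)))
      rw [hact _ (hmr j) (hm0 j), hP.1 _ (hle _ (hmr j))] at h1
      have h2 := hma j
      have h3 := hle _ (hmr j)
      have h4 := hmr j
      omega
    simp only [hdim, Finset.sum_sub_distrib, Finset.sum_const, Finset.card_univ, Fintype.card_fin,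
      nsmul_eq_mul]
    push_cast
    ring
  · intro φ
    rw [mem_schubertTangent]
    constructor
    · intro h j
      rcases hm0 j with ⟨h0, h00⟩ | h0
      · rw [h0, h00, hP.zero_eq_top hH, Submodule.map_top, Submodule.range_mkQ]
        exact Submodule.mem_top
      · refine h (m j) ⟨hmr j, h0⟩ ?_
        rw [hcomap _ (hmr j) h0, hB]
        exact hU.antitone (hmj j) j.2.le (he j j.2).1
    · rintro h i ⟨hir, hi⟩
      rw [hcomap i hir hi]
      refine hU.le_of_adapted he (i := i) (by omega) fun l hl hil => ?_
      have h1 := h ⟨l, hl⟩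
      rw [hB] at h1
      exact Submodule.map_mono
        (hP.antitone (le_of_lt_succ_steps ha (hmax ⟨l, hl⟩ i hil hi) (hmr _)) (hle _ (hmr _))) h1

/-- An endomorphism preserving the flag induces an element of every Schubert tangent space. -/
theorem mkQ_comp_mem_schubertTangent {d r : ℕ} {P : ℕ → Submodule k H} {a : ℕ → ℕ}
    {Λ : Submodule k H} (hle : ∀ i ≤ r, a i ≤ d) {ψ : H →ₗ[k] H}
    (hψ : ∀ i ≤ d, P i ≤ (P i).comap ψ) :
    Λ.mkQ ∘ₗ ψ ∘ₗ Λ.subtype ∈ schubertTangent k P a Λ {i | i ≤ r ∧ ActiveIdx a i} :=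
  mem_schubertTangent.mpr fun i hi _ hx =>
    Submodule.mem_map_of_mem (hψ (a i) (hle i hi.1) hx)

theorem FlagsTransverse.inf_eq_bot [FiniteDimensional k H] {d : ℕ} {P Q : ℕ → Submodule k H}
    (hP : IsCompleteFlag k d P) (hQ : IsCompleteFlag k d Q) (h : FlagsTransverse k d P Q)
    {i : ℕ} (hi : i ≤ d) : P i ⊓ Q (d - i) = ⊥ := by
  rcases Nat.eq_zero_or_pos i with rfl | h0
  · rw [Nat.sub_zero, hQ.last_eq_bot, inf_bot_eq]
  · rcases hi.eq_or_lt with rfl | hd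
    · rw [hP.last_eq_bot, bot_inf_eq]
    · exact h i h0 hd

theorem FlagsTransverse.sup_eq_top [FiniteDimensional k H] {d : ℕ} (hH : finrank k H = d)
    {P Q : ℕ → Submodule k H} (hP : IsCompleteFlag k d P) (hQ : IsCompleteFlag k d Q)
    (h : FlagsTransverse k d P Q) {i : ℕ} (hi : i ≤ d) : P i ⊔ Q (d - i) = ⊤ := by
  refine Submodule.eq_top_of_finrank_eq ?_
  have h1 := Submodule.finrank_sup_add_finrank_inf_eq (P i) (Q (d - i))
  rw [h.inf_eq_bot hP hQ hi, finrank_bot, hP.1 i hi, hQ.1 (d - i) (by omega)] at h1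
  omega

/-- A system adapted to both members of a transverse pair of flags, in opposite orders. -/
theorem FlagsTransverse.exists_adapted [FiniteDimensional k H] {d : ℕ} (hH : finrank k H = d)
    {P Q : ℕ → Submodule k H} (hP : IsCompleteFlag k d P) (hQ : IsCompleteFlag k d Q)
    (h : FlagsTransverse k d P Q) :
    ∃ e : ℕ → H, (∀ i < d, e i ∈ P i ∧ e i ∉ P (i + 1)) ∧
      ∀ i < d, e (d - 1 - i) ∈ Q i ∧ e (d - 1 - i) ∉ Q (i + 1) := by
  have hex : ∀ i, ∃ x, i < d → x ∈ P i ⊓ Q (d - (i + 1)) ∧ x ≠ 0 := fun i => by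
    by_cases hi : i < d
    · obtain ⟨x, hx, hx0⟩ := Submodule.exists_mem_ne_zero_of_ne_bot
        (p := P i ⊓ Q (d - (i + 1))) (fun h0 => by
          have h1 := Submodule.finrank_sup_add_finrank_inf_eq (P i) (Q (d - (i + 1)))
          rw [h0, finrank_bot, hP.1 i hi.le, hQ.1 _ (by omega)] at h1
          have h2 := Submodule.finrank_le (P i ⊔ Q (d - (i + 1)))
          omega)
      exact ⟨x, fun _ => ⟨hx, hx0⟩⟩
    · exact ⟨0, fun h => absurd h hi⟩
  choose e he using hex
  refine ⟨e, fun i hi => ⟨(he i hi).1.1, fun hmem => (he i hi).2 ?_⟩,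
    fun i hi => ⟨?_, fun hmem => (he (d - 1 - i) (by omega)).2 ?_⟩⟩
  · rw [← Submodule.mem_bot k, ← h.inf_eq_bot hP hQ (i := i + 1) hi]
    exact ⟨hmem, (he i hi).1.2⟩
  · have h1 := (he (d - 1 - i) (by omega)).1.2
    rwa [show d - (d - 1 - i + 1) = i by omega] at h1
  · rw [← Submodule.mem_bot k, ← h.inf_eq_bot hP hQ (i := d - 1 - i) (by omega)]
    refine ⟨(he (d - 1 - i) (by omega)).1.1, ?_⟩
    rwa [show d - (d - 1 - i) = i + 1 by omega]

/-- Given two transverse flags, every endomorphism is the sum of one preserving the first flag and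
one preserving the second. -/
theorem FlagsTransverse.exists_add_eq [FiniteDimensional k H] {d : ℕ} (hH : finrank k H = d)
    {P Q : ℕ → Submodule k H} (hP : IsCompleteFlag k d P) (hQ : IsCompleteFlag k d Q)
    (h : FlagsTransverse k d P Q) (ψ : H →ₗ[k] H) :
    ∃ ψ₁ ψ₂ : H →ₗ[k] H, ψ₁ + ψ₂ = ψ ∧ (∀ i ≤ d, P i ≤ (P i).comap ψ₁) ∧
      ∀ i ≤ d, Q i ≤ (Q i).comap ψ₂ := by
  obtain ⟨e, heP, heQ⟩ := h.exists_adapted hH hP hQ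
  obtain ⟨B, hB⟩ := hP.exists_basis hH heP
  have hsplit : ∀ i : Fin d, ∃ x ∈ P i, ∃ y ∈ Q (d - i), x + y = ψ (B i) := fun i =>
    Submodule.mem_sup.mp (by rw [h.sup_eq_top hH hP hQ i.2.le]; exact Submodule.mem_top)
  choose x hx y hy hxy using hsplit
  refine ⟨B.constr k x, B.constr k y, B.ext fun i => ?_, fun i hi => ?_, fun i hi => ?_⟩
  · rw [LinearMap.add_apply, B.constr_basis, B.constr_basis, hxy]
  · refine hP.le_of_adapted heP hi fun l hl hil => ?_
    rw [Submodule.mem_comap, ← hB ⟨l, hl⟩, B.constr_basis]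
    exact hP.antitone hil hl.le (hx ⟨l, hl⟩)
  · refine hQ.le_of_adapted heQ hi fun l hl hil => ?_
    have hl' : d - 1 - l < d := by omega
    rw [Submodule.mem_comap, ← hB ⟨d - 1 - l, hl'⟩, B.constr_basis]
    exact hQ.antitone (by simp only; omega) (by simp only; omega) (hy ⟨d - 1 - l, hl'⟩)

end FlagLemmas

/-- Corollary 2.12 of the paper: for transverse flags and
`Λ ∈ Σ°_{P,a} ∩ Σ°_{Q,b}`, the tangent-space model `T(Λ)` has the expected
dimension `E = (r+1)(d-r-1) - Σ_i (a_i - i) - Σ_i (b_i - i)`. -/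
theorem pairTangent_dim_transverse (k H : Type*) [Field k] [IsAlgClosed k]
    [AddCommGroup H] [Module k H] (d : ℕ) (hd : 1 ≤ d)
    (hH : Module.finrank k H = d) (P Q : ℕ → Submodule k H)
    (hP : IsCompleteFlag k d P) (hQ : IsCompleteFlag k d Q)
    (htrans : FlagsTransverse k d P Q)
    (r : ℕ) (a b : ℕ → ℕ)
    (ha : ∀ i < r, a i < a (i + 1)) (had : a r < d)
    (hb : ∀ i < r, b i < b (i + 1)) (hbd : b r < d)
    (Λ : Submodule k H) (hΛ : Module.finrank k ↥Λ = r + 1)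
    (hΛa : MemSchubertOpen k r P a Λ) (hΛb : MemSchubertOpen k r Q b Λ) :
    (Module.finrank k ↥(pairTangent k r P Q a b Λ) : ℤ) =
      ((r : ℤ) + 1) * ((d : ℤ) - (r : ℤ) - 1) -
        (∑ i ∈ Finset.range (r + 1), ((a i : ℤ) - (i : ℤ))) -
        (∑ i ∈ Finset.range (r + 1), ((b i : ℤ) - (i : ℤ))) := by
  have : FiniteDimensional k H := Module.finite_of_finrank_pos (by omega)
  have hTP := finrank_schubertTangent hH hP ha had hΛ hΛa
  have hTQ := finrank_schubertTangent hH hQ hb hbd hΛ hΛb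
  have hsup : schubertTangent k P a Λ {i | i ≤ r ∧ ActiveIdx a i} ⊔
      schubertTangent k Q b Λ {i | i ≤ r ∧ ActiveIdx b i} = ⊤ := by
    refine eq_top_iff.mpr fun φ _ => ?_
    obtain ⟨s, hs⟩ := Λ.mkQ.exists_rightInverse_of_surjective Λ.range_mkQ
    obtain ⟨ψ, hψ⟩ := LinearMap.exists_extend (s ∘ₗ φ)
    obtain ⟨ψ₁, ψ₂, hadd, h₁, h₂⟩ := htrans.exists_add_eq hH hP hQ ψ
    refine Submodule.mem_sup.mpr
      ⟨_, mkQ_comp_mem_schubertTangent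
        (fun i hi => (le_of_lt_succ_steps ha hi le_rfl).trans had.le) h₁,
       _, mkQ_comp_mem_schubertTangent
        (fun i hi => (le_of_lt_succ_steps hb hi le_rfl).trans hbd.le) h₂, ?_⟩
    rw [← LinearMap.comp_add, ← LinearMap.add_comp, hadd, hψ, ← LinearMap.comp_assoc, hs,
      LinearMap.id_comp]
  have hdim := Submodule.finrank_sup_add_finrank_inf_eq
    (schubertTangent k P a Λ {i | i ≤ r ∧ ActiveIdx a i})
    (schubertTangent k Q b Λ {i | i ≤ r ∧ ActiveIdx b i})
  have hquot : (finrank k (H ⧸ Λ) : ℤ) = (d : ℤ) - r - 1 := by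
    have := Λ.finrank_quotient_add_finrank
    omega
  rw [hsup, finrank_top, Module.finrank_linearMap, hΛ] at hdim
  zify at hdim
  rw [hquot, hTP, hTQ] at hdim
  rw [pairTangent]
  linarith
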